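/- arXiv:2207.04570 — 7 statements merged into one kernel-verified Lean document; each statement's English description precedes it below -/
import Mathlib

section
/- Let (X,G,ν) be an augmented rack, A an abelian group, and φ̄ : X×G → A an action-additive function. Then the 2-cochain φ(x,y) := φ̄(x,ν(y)) is a rack 2-cocycle on (X,*), and it is both fibrant and additive. -/
/-- If φ̄ : X×G → A is action-additive, then φ(x,y) := φ̄(x,ν(y))
is a rack 2-cocycle on (X,*), and is fibrant and additive. -/
theorem stmt_2 {X G A : Type*} [Group G] [AddCommGroup A]
    (act : X → G → X) (ν : X → G)
    (hact : ∀ (x : X) (g h : G), act (act x g) h = act x (g * h))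
    (hν : ∀ (x : X) (g : G), ν (act x g) = g⁻¹ * ν x * g)
    (φb : X → G → A)
    (haddact : ∀ (w : X) (g h : G), φb w g + φb (act w g) h = φb w (g * h)) :
    -- φ(x,y) := φb x (ν y) is a rack 2-cocycle
    (∀ x y z : X,
      φb x (ν y) + φb (act x (ν y)) (ν z)
        = φb x (ν z) + φb (act x (ν z)) (ν (act y (ν z)))) ∧
    -- φ is fibrant
    (∀ x y z : X, ν y = ν z → φb x (ν y) = φb x (ν z)) ∧
    -- φ is additive
    (∀ w x y z : X, ν x * ν y = ν z →
      φb w (ν x) + φb (act w (ν x)) (ν y) = φb w (ν z)) := by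
  refine ⟨fun x y z => ?_, fun x y z h => by rw [h], fun w x y z h => by rw [haddact, h]⟩
  rw [haddact, haddact, hν]
  congr 1
  group
end

section
/- Let p : G̃ → G be a surjective group homomorphism whose kernel is contained in the center of G̃, let s : G → G̃ be a set-theoretic section of p (i.e. p(s(g)) = g for all g ∈ G), and let Q̃ ⊆ G̃ be a subset closed under conjugation by all elements of G̃. Define x·g := s(g)⁻¹ x s(g) for x ∈ Q̃ and g ∈ G. Then (x·g)·h = x·(gh) for all x ∈ Q̃ and g,h ∈ G (so · is a right G-action on Q̃), and p(x·g) = g⁻¹ p(x) g for all x ∈ Q̃, g ∈ G; hence (Q̃, G, p restricted to Q̃) is an augmented rack. -/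
/-- If `p` has central kernel, conjugation by `a` depends only on `p a`. -/
theorem conj_eq_conj_of_map_eq {Gt G : Type*} [Group Gt] [Group G] (p : Gt →* G)
    (hcent : ∀ k : Gt, p k = 1 → ∀ a : Gt, k * a = a * k)
    {a b : Gt} (hab : p a = p b) (x : Gt) : a⁻¹ * x * a = b⁻¹ * x * b := by
  have hk : a * b⁻¹ * x = x * (a * b⁻¹) := hcent _ (by simp [hab]) x
  calc a⁻¹ * x * a = a⁻¹ * (x * (a * b⁻¹)) * b := by group
    _ = a⁻¹ * (a * b⁻¹ * x) * b := by rw [hk]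
    _ = b⁻¹ * x * b := by group

/-- Let p : G̃ → G be a surjective homomorphism with central kernel,
s a set-theoretic section of p, and Q̃ ⊆ G̃ closed under conjugation. Then
x·g := s(g)⁻¹ x s(g) is a right G-action on Q̃, and p(x·g) = g⁻¹ p(x) g; hence
(Q̃, G, p|_{Q̃}) is an augmented rack. -/
theorem stmt_4 {Gt G : Type*} [Group Gt] [Group G]
    (p : Gt →* G) (hsurj : Function.Surjective p)
    (hcent : ∀ k : Gt, p k = 1 → ∀ a : Gt, k * a = a * k)
    (s : G → Gt) (hs : ∀ g : G, p (s g) = g)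
    (Q : Set Gt) (hQ : ∀ x ∈ Q, ∀ g : Gt, g⁻¹ * x * g ∈ Q) :
    (∀ x ∈ Q, ∀ g : G, (s g)⁻¹ * x * s g ∈ Q) ∧
    (∀ x ∈ Q, ∀ g h : G,
      (s h)⁻¹ * ((s g)⁻¹ * x * s g) * s h = (s (g * h))⁻¹ * x * s (g * h)) ∧
    (∀ x ∈ Q, ∀ g : G, p ((s g)⁻¹ * x * s g) = g⁻¹ * p x * g) := by
  refine ⟨fun x hx g => hQ x hx (s g), fun x _ g h => ?_, fun x _ g => by simp [hs]⟩
  rw [← conj_eq_conj_of_map_eq p hcent (a := s g * s h) (b := s (g * h)) (by simp [hs]) x]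
  simp only [mul_inv_rev, mul_assoc]
end

section
/- Let (X,G,ν) be an augmented rack, A an abelian group, and η a group 2-cocycle on G with coefficients in A. Define the η-derived 2-cochain φ : X×X → A by φ(x,y) = −η(e,e) − η(ν(y),ν(y)⁻¹) + η(ν(y)⁻¹,ν(x)) + η(ν(y)⁻¹ν(x),ν(y)). Then for all x,y,z,w ∈ X with ν(x)ν(y) = ν(z): φ(x,w) + φ(y,w) + η(ν(w)⁻¹ν(x)ν(w), ν(w)⁻¹ν(y)ν(w)) = φ(z,w) + η(ν(x),ν(y)). -/
/-- The η-derived 2-cochain of an augmented rack. -/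
def etaDerived {X G A : Type*} [Group G] [AddCommGroup A]
    (ν : X → G) (η : G → G → A) (x y : X) : A :=
  -η 1 1 - η (ν y) (ν y)⁻¹ + η (ν y)⁻¹ (ν x) + η ((ν y)⁻¹ * ν x) (ν y)

/-- For the η-derived 2-cochain φ of an augmented rack (X,G,ν),
for all x,y,z,w with ν(x)ν(y) = ν(z):
φ(x,w) + φ(y,w) + η(ν(w)⁻¹ν(x)ν(w), ν(w)⁻¹ν(y)ν(w)) = φ(z,w) + η(ν(x),ν(y)). -/
theorem stmt_7 {X G A : Type*} [Group G] [AddCommGroup A]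
    (act : X → G → X) (ν : X → G)
    (hact : ∀ (x : X) (g h : G), act (act x g) h = act x (g * h))
    (hν : ∀ (x : X) (g : G), ν (act x g) = g⁻¹ * ν x * g)
    (η : G → G → A)
    (hη : ∀ g h k : G, η h k + η g (h * k) = η (g * h) k + η g h) :
    ∀ x y z w : X, ν x * ν y = ν z →
      etaDerived ν η x w + etaDerived ν η y w
        + η ((ν w)⁻¹ * ν x * ν w) ((ν w)⁻¹ * ν y * ν w)
        = etaDerived ν η z w + η (ν x) (ν y) := by
  intro x y z w hz
  simp only [etaDerived, ← hz]
  generalize ν x = a, ν y = b, ν w = c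
  have h₁ := hη (c⁻¹ * a) c (c⁻¹ * b * c)
  have h₂ := hη c (c⁻¹ * b) c
  have h₃ := hη c c⁻¹ b
  have h₄ := hη 1 1 b
  have h₅ := hη (c⁻¹ * a) b c
  have h₆ := hη c⁻¹ a b
  simp only [mul_assoc, mul_inv_cancel_left, mul_inv_cancel, one_mul] at *
  linear_combination (norm := abel) -h₁ + h₂ + h₃ + h₄ + h₅ - h₆
end

section
/- Let G be a group, A an abelian group, and η a normalized group 2-cocycle on G with coefficients in A which additionally satisfies η(g,g⁻¹) = 0 for all g ∈ G. Then the two rack 2-cocycle constructions from η coincide: η(g,h) − η(h,h⁻¹gh) = η(h⁻¹,g) + η(h⁻¹g,h) for all g,h ∈ G. -/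
/-- For a normalized group 2-cocycle η with η(g,g⁻¹) = 0 for all g,
the two rack 2-cocycle constructions coincide:
η(g,h) − η(h,h⁻¹gh) = η(h⁻¹,g) + η(h⁻¹g,h). -/
theorem stmt_11 {G A : Type*} [Group G] [AddCommGroup A]
    (η : G → G → A)
    (hη : ∀ g h k : G, η h k + η g (h * k) = η (g * h) k + η g h)
    (hnorm : η 1 1 = 0)
    (hinv : ∀ g : G, η g g⁻¹ = 0) :
    ∀ g h : G,
      η g h - η h (h⁻¹ * g * h) = η h⁻¹ g + η (h⁻¹ * g) h := by
  intro g h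
  have one_left (x : G) : η 1 x = 0 := by
    simpa [hnorm] using hη 1 1 x
  have inv_left : η h⁻¹ (g * h) + η h (h⁻¹ * g * h) = 0 := by
    simpa [hinv, one_left, mul_assoc] using hη h h⁻¹ (g * h)
  rw [add_comm (η h⁻¹ g), ← hη h⁻¹ g h, eq_neg_of_add_eq_zero_left inv_left, sub_eq_add_neg]
end

section
/- Let (X,G,ν) be an augmented rack, A an abelian group, and η a normalized group 2-cocycle on G with coefficients in A which additionally satisfies η(g,g⁻¹) = 0 for all g ∈ G. Define φ : X×X → A by φ(x,y) = η(ν(y)⁻¹,ν(x)) + η(ν(y)⁻¹ν(x),ν(y)). Then φ is additive: φ(w,x) + φ(w*x,y) = φ(w,z) for all w,x,y,z ∈ X with ν(x)ν(y) = ν(z). -/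
/-- For an augmented rack (X,G,ν) and a normalized group 2-cocycle η
with η(g,g⁻¹) = 0 for all g, the 2-cochain
φ(x,y) = η(ν(y)⁻¹,ν(x)) + η(ν(y)⁻¹ν(x),ν(y)) is additive:
φ(w,x) + φ(w*x,y) = φ(w,z) whenever ν(x)ν(y) = ν(z) (where w*x = w·ν(x)). -/
theorem stmt_12 {X G A : Type*} [Group G] [AddCommGroup A]
    (act : X → G → X) (ν : X → G)
    (hact : ∀ (x : X) (g h : G), act (act x g) h = act x (g * h))
    (hν : ∀ (x : X) (g : G), ν (act x g) = g⁻¹ * ν x * g)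
    (η : G → G → A)
    (hη : ∀ g h k : G, η h k + η g (h * k) = η (g * h) k + η g h)
    (hnorm : η 1 1 = 0)
    (hinv : ∀ g : G, η g g⁻¹ = 0) :
    ∀ w x y z : X, ν x * ν y = ν z →
      (η (ν x)⁻¹ (ν w) + η ((ν x)⁻¹ * ν w) (ν x))
        + (η (ν y)⁻¹ (ν (act w (ν x))) + η ((ν y)⁻¹ * ν (act w (ν x))) (ν y))
        = η (ν z)⁻¹ (ν w) + η ((ν z)⁻¹ * ν w) (ν z) := by
  intro w x y z hz
  rw [← hz, hν, mul_inv_rev]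
  generalize ν w = a
  generalize ν x = p
  generalize ν y = q
  have one_left : η 1 p⁻¹ = 0 := by
    have h := hη 1 1 p⁻¹
    rw [one_mul, one_mul, hnorm] at h
    exact add_left_cancel h
  have hpq : η q⁻¹ p⁻¹ + η p q = 0 := by
    have h₁ := hη p q (q⁻¹ * p⁻¹)
    have h₂ := hη q q⁻¹ p⁻¹
    have h₃ := hinv (p * q)
    rw [mul_inv_rev] at h₃
    rw [mul_inv_cancel_left, hinv, h₃, add_zero, zero_add] at h₁
    rwa [mul_inv_cancel, one_left, hinv, h₁, add_zero] at h₂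
  have h₁ := hη q⁻¹ p⁻¹ a
  have h₂ := hη q⁻¹ (p⁻¹ * a) p
  have h₃ := hη (q⁻¹ * p⁻¹ * a) p q
  simp only [mul_assoc] at h₁ h₂ h₃ ⊢
  grind
end

section
/- Let G be a group, A an abelian group, and η a group 2-cocycle on G with coefficients in A. Define φ'(k,g) := η(k,g) − η(g,g⁻¹kg) for k,g ∈ G. Then φ'(k,g) + φ'(g⁻¹kg,h) = φ'(k,gh) for all g,h,k ∈ G. -/
/-- For a group 2-cocycle η, the function
φ'(k,g) := η(k,g) − η(g,g⁻¹kg) satisfies φ'(k,g) + φ'(g⁻¹kg,h) = φ'(k,gh). -/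
theorem stmt_13 {G A : Type*} [Group G] [AddCommGroup A]
    (η : G → G → A)
    (hη : ∀ g h k : G, η h k + η g (h * k) = η (g * h) k + η g h) :
    ∀ g h k : G,
      (η k g - η g (g⁻¹ * k * g))
        + (η (g⁻¹ * k * g) h - η h (h⁻¹ * (g⁻¹ * k * g) * h))
        = η k (g * h) - η (g * h) ((g * h)⁻¹ * k * (g * h)) := by
  intro g h k
  have hconj : (g * h)⁻¹ * k * (g * h) = h⁻¹ * (g⁻¹ * k * g) * h := by group
  have hm : g * (g⁻¹ * k * g) = k * g := by group
  have hn : h * (h⁻¹ * (g⁻¹ * k * g) * h) = g⁻¹ * k * g * h := by group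
  have h₁ := hη k g h
  have h₂ := hη g (g⁻¹ * k * g) h
  have h₃ := hη g h (h⁻¹ * (g⁻¹ * k * g) * h)
  rw [hm] at h₂
  rw [hn] at h₃
  rw [hconj]
  generalize h⁻¹ * (g⁻¹ * k * g) * h = n at *
  generalize g⁻¹ * k * g = m at *
  clear hη hconj hm hn
  grind
end

section
/- Let G be a group, A an abelian group, and η a group 2-cocycle on G with coefficients in A. Equip G with the conjugation rack operation g*h := h⁻¹gh. Then the function φ'(g,h) := η(g,h) − η(h,h⁻¹gh) is a rack 2-cocycle on the conjugation rack: φ'(x,y) + φ'(x*y,z) = φ'(x,z) + φ'(x*z,y*z) for all x,y,z ∈ G. -/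
/-- For a group 2-cocycle η on G, the function
φ'(g,h) := η(g,h) − η(h,h⁻¹gh) is a rack 2-cocycle on the conjugation rack
g*h := h⁻¹gh. -/
theorem stmt_14 {G A : Type*} [Group G] [AddCommGroup A]
    (η : G → G → A)
    (hη : ∀ g h k : G, η h k + η g (h * k) = η (g * h) k + η g h) :
    ∀ x y z : G,
      (η x y - η y (y⁻¹ * x * y))
        + (η (y⁻¹ * x * y) z - η z (z⁻¹ * (y⁻¹ * x * y) * z))
        = (η x z - η z (z⁻¹ * x * z))
          + (η (z⁻¹ * x * z) (z⁻¹ * y * z)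
            - η (z⁻¹ * y * z) ((z⁻¹ * y * z)⁻¹ * (z⁻¹ * x * z) * (z⁻¹ * y * z))) := by
  intro x y z
  obtain ⟨p, hp⟩ : ∃ p, p = y⁻¹ * x * y := ⟨_, rfl⟩
  obtain ⟨q, hq⟩ : ∃ q, q = z⁻¹ * x * z := ⟨_, rfl⟩
  obtain ⟨r, hr⟩ : ∃ r, r = z⁻¹ * y * z := ⟨_, rfl⟩
  obtain ⟨s, hs⟩ : ∃ s, s = z⁻¹ * p * z := ⟨_, rfl⟩
  have hrs : r⁻¹ * q * r = s := by subst hs hp hq hr; group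
  have hyp : y * p = x * y := by subst hp; group
  have hzq : z * q = x * z := by subst hq; group
  have hzr : z * r = y * z := by subst hr; group
  have hzs : z * s = p * z := by subst hs; group
  have hrs' : r * s = q * r := by rw [← hrs]; group
  rw [← hp, ← hq, ← hr, ← hs, hrs]
  have h₁ := hη x y z
  have h₂ := hη y p z
  have h₃ := hη y z s
  have h₄ := hη x z r
  have h₅ := hη z q r
  have h₆ := hη z r s
  rw [hyp] at h₂
  rw [hzs] at h₃
  rw [hzr] at h₄ h₆
  rw [hzq] at h₅
  rw [hrs'] at h₆
  linear_combination (norm := module) h₂ - h₁ - h₃ + h₄ - h₅ + h₆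
end
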